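/- Let a, b, c > 0 be real numbers and s a complex number with Re(s) > 0. Write G_b^a(s) := coth(as/c)·tanh(bs/c) − 1 and G_a^b(s) := coth(bs/c)·tanh(as/c) − 1. Then G_b^a(s) + G_a^b(s) = 4 ∑_{m=1}^∞ (e^{-4ams/c} + e^{-4bms/c}) − 4 ∑_{m=1}^∞ ∑_{n=1}^∞ (-1)^{n-1} (e^{-2(am+bn)s/c} + e^{-2(an+bm)s/c}), where all series converge absolutely. -/

import Mathlib

open Complex

lemma hasSum_pow_succ_of_norm_lt_one {x : ℂ} (hx : ‖x‖ < 1) :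
    HasSum (fun m : ℕ => x ^ (m + 1)) (x / (1 - x)) := by
  simpa [pow_succ', div_eq_mul_inv] using (hasSum_geometric_of_norm_lt_one hx).mul_left x

lemma hasSum_alternating_pow_succ_of_norm_lt_one {x : ℂ} (hx : ‖x‖ < 1) :
    HasSum (fun n : ℕ => (-1) ^ n * x ^ (n + 1)) (x / (1 + x)) := by
  have h := (hasSum_geometric_of_norm_lt_one (ξ := -x) (by simpa using hx)).mul_left x
  rw [sub_neg_eq_add, ← div_eq_mul_inv] at h
  refine h.congr_fun fun n => ?_
  rw [neg_pow x]
  ring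

lemma summable_norm_pow_succ_of_norm_lt_one {x : ℂ} (hx : ‖x‖ < 1) :
    Summable (fun m : ℕ => ‖x ^ (m + 1)‖) :=
  (summable_norm_geometric_of_norm_lt_one hx).comp_injective (add_left_injective 1)

lemma Complex.norm_exp_neg_two_mul_lt_one {z : ℂ} (hz : 0 < z.re) : ‖exp (-2 * z)‖ < 1 := by
  rw [norm_exp, Real.exp_lt_one_iff]
  simpa using hz

lemma one_sub_ne_zero_of_norm_lt_one {x : ℂ} (hx : ‖x‖ < 1) : 1 - x ≠ 0 := by
  intro h
  rw [← sub_eq_zero.mp h] at hx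
  simp at hx

lemma one_add_ne_zero_of_norm_lt_one {x : ℂ} (hx : ‖x‖ < 1) : 1 + x ≠ 0 := by
  simpa using one_sub_ne_zero_of_norm_lt_one (x := -x) (by simpa using hx)

lemma Complex.sinh_eq_exp_mul_one_sub (z : ℂ) :
    sinh z = exp z * (1 - exp (-2 * z)) / 2 := by
  rw [sinh, mul_sub, ← exp_add]
  ring_nf

lemma Complex.cosh_eq_exp_mul_one_add (z : ℂ) :
    cosh z = exp z * (1 + exp (-2 * z)) / 2 := by
  rw [cosh, mul_add, ← exp_add]
  ring_nf

lemma coth_mul_tanh_add_coth_mul_tanh {z w : ℂ} (hz : 0 < z.re) (hw : 0 < w.re) :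
    (cosh z / sinh z * tanh w - 1) + (cosh w / sinh w * tanh z - 1) =
      4 * (exp (-2 * z) ^ 2 / (1 - exp (-2 * z) ^ 2) + exp (-2 * w) ^ 2 / (1 - exp (-2 * w) ^ 2))
      - 4 * (exp (-2 * z) / (1 - exp (-2 * z)) * (exp (-2 * w) / (1 + exp (-2 * w)))
        + exp (-2 * w) / (1 - exp (-2 * w)) * (exp (-2 * z) / (1 + exp (-2 * z)))) := by
  have hx := norm_exp_neg_two_mul_lt_one hz
  have hy := norm_exp_neg_two_mul_lt_one hw
  rw [tanh_eq_sinh_div_cosh, tanh_eq_sinh_div_cosh, sinh_eq_exp_mul_one_sub z,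
    sinh_eq_exp_mul_one_sub w, cosh_eq_exp_mul_one_add z, cosh_eq_exp_mul_one_add w]
  have hez := exp_ne_zero z
  have hew := exp_ne_zero w
  generalize exp (-2 * z) = x at *
  generalize exp (-2 * w) = y at *
  have h1 := one_sub_ne_zero_of_norm_lt_one hx
  have h2 := one_add_ne_zero_of_norm_lt_one hx
  have h3 := one_sub_ne_zero_of_norm_lt_one hy
  have h4 := one_add_ne_zero_of_norm_lt_one hy
  rw [show 1 - x ^ 2 = (1 - x) * (1 + x) by ring, show 1 - y ^ 2 = (1 - y) * (1 + y) by ring]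
  field_simp
  ring

/-- Kernel expansion for the NNWR convergence kernel `G_b^a(s) + G_a^b(s)`, where
`G_b^a(s) = coth(as/c)·tanh(bs/c) − 1` and `coth z = cosh z / sinh z`:
`G_b^a(s) + G_a^b(s) = 4 ∑_{m≥1} (e^{-4ams/c} + e^{-4bms/c})
  − 4 ∑_{m≥1} ∑_{n≥1} (-1)^{n-1} (e^{-2(am+bn)s/c} + e^{-2(an+bm)s/c})`,
with all series absolutely summable. Sums over indices `≥ 1` are indexed by `ℕ`
via `m ↦ m + 1`, `n ↦ n + 1`. -/
theorem NNWR_kernel_expansion (a b c : ℝ) (ha : 0 < a) (hb : 0 < b) (hc : 0 < c)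
    (s : ℂ) (hs : 0 < s.re) :
    Summable (fun m : ℕ => ‖exp (-4 * (a : ℂ) * ((m : ℂ) + 1) * s / c)
      + exp (-4 * (b : ℂ) * ((m : ℂ) + 1) * s / c)‖) ∧
    Summable (fun p : ℕ × ℕ => ‖(-1 : ℂ) ^ p.2 *
      (exp (-2 * ((a : ℂ) * ((p.1 : ℂ) + 1) + (b : ℂ) * ((p.2 : ℂ) + 1)) * s / c)
       + exp (-2 * ((a : ℂ) * ((p.2 : ℂ) + 1) + (b : ℂ) * ((p.1 : ℂ) + 1)) * s / c))‖) ∧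
    (cosh ((a : ℂ) * s / c) / sinh ((a : ℂ) * s / c) * tanh ((b : ℂ) * s / c) - 1)
      + (cosh ((b : ℂ) * s / c) / sinh ((b : ℂ) * s / c) * tanh ((a : ℂ) * s / c) - 1) =
    4 * (∑' m : ℕ, (exp (-4 * (a : ℂ) * ((m : ℂ) + 1) * s / c)
          + exp (-4 * (b : ℂ) * ((m : ℂ) + 1) * s / c)))
    - 4 * (∑' m : ℕ, ∑' n : ℕ, (-1 : ℂ) ^ n *
        (exp (-2 * ((a : ℂ) * ((m : ℂ) + 1) + (b : ℂ) * ((n : ℂ) + 1)) * s / c)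
         + exp (-2 * ((a : ℂ) * ((n : ℂ) + 1) + (b : ℂ) * ((m : ℂ) + 1)) * s / c))) := by
  have hre : ∀ r : ℝ, 0 < r → 0 < ((r : ℂ) * s / c).re := fun r hr => by
    rw [div_ofReal_re, re_ofReal_mul]
    positivity
  have hx := norm_exp_neg_two_mul_lt_one (hre a ha)
  have hy := norm_exp_neg_two_mul_lt_one (hre b hb)
  rw [coth_mul_tanh_add_coth_mul_tanh (hre a ha) (hre b hb)]
  have hsingle : ∀ (r : ℝ) (m : ℕ), exp (-4 * (r : ℂ) * ((m : ℂ) + 1) * s / c) =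
      (exp (-2 * ((r : ℂ) * s / c)) ^ 2) ^ (m + 1) := fun r m => by
    rw [← pow_mul, ← exp_nat_mul]
    push_cast
    ring_nf
  have hmixed : ∀ m n : ℕ,
      exp (-2 * ((a : ℂ) * ((m : ℂ) + 1) + (b : ℂ) * ((n : ℂ) + 1)) * s / c) =
      exp (-2 * ((a : ℂ) * s / c)) ^ (m + 1) * exp (-2 * ((b : ℂ) * s / c)) ^ (n + 1) :=
    fun m n => by
      rw [← exp_nat_mul, ← exp_nat_mul, ← exp_add]
      push_cast
      ring_nf
  simp only [hsingle, hmixed]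
  generalize exp (-2 * ((a : ℂ) * s / c)) = x at *
  generalize exp (-2 * ((b : ℂ) * s / c)) = y at *
  have hx2 : ‖x ^ 2‖ < 1 := by
    rw [norm_pow]
    exact pow_lt_one₀ (norm_nonneg x) hx two_ne_zero
  have hy2 : ‖y ^ 2‖ < 1 := by
    rw [norm_pow]
    exact pow_lt_one₀ (norm_nonneg y) hy two_ne_zero
  refine ⟨?_, ?_, ?_⟩
  · exact ((summable_norm_pow_succ_of_norm_lt_one hx2).add
      (summable_norm_pow_succ_of_norm_lt_one hy2)).of_nonneg_of_le
      (fun _ => norm_nonneg _) fun _ => norm_add_le _ _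
  · have hxs := summable_norm_pow_succ_of_norm_lt_one hx
    have hys := summable_norm_pow_succ_of_norm_lt_one hy
    refine ((hxs.mul_norm hys).add (hys.mul_norm hxs)).of_nonneg_of_le
      (fun _ => norm_nonneg _) fun p => ?_
    rw [norm_mul, norm_pow, norm_neg, norm_one, one_pow, one_mul, mul_comm (y ^ (p.1 + 1))]
    exact norm_add_le _ _
  · have hinner : ∀ m : ℕ, ∑' n : ℕ, (-1 : ℂ) ^ n *
        (x ^ (m + 1) * y ^ (n + 1) + x ^ (n + 1) * y ^ (m + 1)) =
        x ^ (m + 1) * (y / (1 + y)) + y ^ (m + 1) * (x / (1 + x)) := fun m => by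
      refine (HasSum.congr_fun
        (((hasSum_alternating_pow_succ_of_norm_lt_one hy).mul_left (x ^ (m + 1))).add
          ((hasSum_alternating_pow_succ_of_norm_lt_one hx).mul_left (y ^ (m + 1))))
        fun n => ?_).tsum_eq
      ring
    rw [tsum_congr hinner,
      (((hasSum_pow_succ_of_norm_lt_one hx).mul_right (y / (1 + y))).add
        ((hasSum_pow_succ_of_norm_lt_one hy).mul_right (x / (1 + x)))).tsum_eq,
      ((hasSum_pow_succ_of_norm_lt_one hx2).add (hasSum_pow_succ_of_norm_lt_one hy2)).tsum_eq]
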